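/- arXiv:2603.19447 — 2 statements merged into one kernel-verified Lean document; each statement's English description precedes it below -/
import Mathlib

section
/- Let d ≥ 1 and k ≥ 1 be integers, G a graph on vertex set [n], and C₁,…,C_k cliques of G that cover every edge of G (for every edge {u,v} of G there is j with u,v ∈ C_j). Let M be a G-partial matrix such that M[C_j] is d-embeddable for every j ∈ {1,…,k}. Fix i ∈ {1,…,k}, and for each j ∈ {1,…,k} let X_j be a d-metric basis of M[C_i ∩ C_j]. Let w ∈ C_i \ (X₁ ∪ … ∪ X_k). Then M is d-completable if and only if M − w is d-completable. -/
/-- `M` is a `G`-partial matrix: the specified entries (those indexed by edges of `G`)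
are symmetric and nonnegative, and the diagonal is zero.  Entries at non-edges are
unspecified (their values are irrelevant). -/
def IsPartialMatrix {V : Type*} (G : SimpleGraph V) (M : V → V → ℝ) : Prop :=
  (∀ i j, G.Adj i j → M i j = M j i) ∧ (∀ i j, G.Adj i j → 0 ≤ M i j) ∧
    (∀ i, M i i = 0)

/-- `q` is a realization of the principal submatrix `M[S]` in `ℝ^d`. -/
def IsRealizationOn {V : Type*} (d : ℕ) (M : V → V → ℝ) (S : Set V)
    (q : V → EuclideanSpace ℝ (Fin d)) : Prop :=
  ∀ u ∈ S, ∀ v ∈ S, dist (q u) (q v) ^ 2 = M u v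

/-- The principal submatrix `M[S]` is `d`-embeddable. -/
def IsEmbeddableOn {V : Type*} (d : ℕ) (M : V → V → ℝ) (S : Set V) : Prop :=
  ∃ q : V → EuclideanSpace ℝ (Fin d), IsRealizationOn d M S q

/-- `B` is a `d`-metric basis of `M[S]`: `M[S]` is `d`-embeddable and in every
realization of `M[S]` in `ℝ^d` the points indexed by `B` are affinely independent and
every point of the realization lies in their affine span. -/
def IsMetricBasisOn {V : Type*} (d : ℕ) (M : V → V → ℝ) (S B : Set V) : Prop :=
  B ⊆ S ∧ IsEmbeddableOn d M S ∧
    ∀ q : V → EuclideanSpace ℝ (Fin d), IsRealizationOn d M S q →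
      AffineIndependent ℝ (fun b : B => q ↑b) ∧
      ∀ v ∈ S, q v ∈ affineSpan ℝ (q '' B)

/-- The `G`-partial matrix `M`, restricted to the vertex set `S`, is `d`-completable:
there are points in `ℝ^d`, one per vertex, realizing all specified entries between
vertices of `S`. -/
def IsCompletableOn {V : Type*} (d : ℕ) (G : SimpleGraph V) (M : V → V → ℝ)
    (S : Set V) : Prop :=
  ∃ p : V → EuclideanSpace ℝ (Fin d), ∀ u ∈ S, ∀ v ∈ S, G.Adj u v →
    dist (p u) (p v) ^ 2 = M u v

/-- The `G`-partial matrix `M` is `d`-completable. -/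
def IsCompletable {V : Type*} (d : ℕ) (G : SimpleGraph V) (M : V → V → ℝ) : Prop :=
  IsCompletableOn d G M Set.univ

/-- Two points are equal as soon as they are equidistant from a family whose affine span contains
one of them. -/
theorem eq_of_mem_affineSpan_of_forall_dist_eq {E : Type*} [NormedAddCommGroup E]
    [InnerProductSpace ℝ E] {s : Set E} {y z : E} (hy : y ∈ affineSpan ℝ s)
    (h : ∀ x ∈ s, dist x y = dist x z) : y = z := by
  have hs : affineSpan ℝ s ≤ AffineSubspace.perpBisector y z :=
    affineSpan_le.2 fun x hx => AffineSubspace.mem_perpBisector_iff_dist_eq.2 (h x hx)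
  exact AffineSubspace.left_mem_perpBisector.1 (hs hy)

/-- Given congruent families `q` and `p` on `S`, any point of the affine span of `q '' S` has a
counterpart with the same distances to the members of `p`. -/
theorem exists_dist_eq_of_mem_affineSpan {V E F : Type*}
    [NormedAddCommGroup E] [InnerProductSpace ℝ E] [NormedAddCommGroup F] [InnerProductSpace ℝ F]
    {S : Set V} {q : V → E} {p : V → F}
    (hqp : ∀ u ∈ S, ∀ v ∈ S, dist (q u) (q v) = dist (p u) (p v))
    {x : E} (hx : x ∈ affineSpan ℝ (q '' S)) :
    ∃ y : F, ∀ u ∈ S, dist (p u) y = dist (q u) x := by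
  classical
  obtain ⟨t, a, ht, ha, rfl⟩ := eq_affineCombination_of_mem_affineSpan_image hx
  refine ⟨t.affineCombination ℝ p a, fun u hu => ?_⟩
  have hsub : t ⊆ insert u t := Finset.subset_insert u t
  have hu' : u ∈ insert u t := Finset.mem_insert_self u t
  have hS : ∀ v ∈ insert u t, v ∈ S := by
    intro v hv
    rcases Finset.mem_insert.1 hv with rfl | hv
    · exact hu
    · exact ht hv
  have ha' : ∑ v ∈ insert u t, (↑t : Set V).indicator a v = 1 := by
    rw [Finset.sum_indicator_subset a hsub, ha]
  have hb : ∑ v ∈ insert u t, (Pi.single u 1 : V → ℝ) v = 1 := by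
    rw [Finset.sum_pi_single', if_pos hu']
  have key : ∀ v ∈ insert u t, v ≠ u → (Pi.single u 1 : V → ℝ) v = 0 :=
    fun v _ hv => Pi.single_eq_of_ne hv 1
  rw [← (insert u t).affineCombination_of_eq_one_of_eq_zero _ p hu' (Pi.single_eq_same u 1) key,
    ← (insert u t).affineCombination_of_eq_one_of_eq_zero _ q hu' (Pi.single_eq_same u 1) key,
    Finset.affineCombination_indicator_subset a p hsub,
    Finset.affineCombination_indicator_subset a q hsub,
    ← mul_self_inj_of_nonneg dist_nonneg dist_nonneg,
    EuclideanGeometry.dist_affineCombination p hb ha',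
    EuclideanGeometry.dist_affineCombination q hb ha']
  congr 2
  exact Finset.sum_congr rfl fun v hv => Finset.sum_congr rfl fun v' hv' => by
    rw [hqp v (hS v hv) v' (hS v' hv')]

theorem IsRealizationOn.mono {V : Type*} {d : ℕ} {M : V → V → ℝ} {S T : Set V}
    {q : V → EuclideanSpace ℝ (Fin d)} (hq : IsRealizationOn d M T q) (h : S ⊆ T) :
    IsRealizationOn d M S q :=
  fun u hu v hv => hq u (h hu) v (h hv)

theorem IsRealizationOn.dist_eq {V : Type*} {d : ℕ} {M : V → V → ℝ} {S : Set V}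
    {q p : V → EuclideanSpace ℝ (Fin d)} (hq : IsRealizationOn d M S q)
    (hp : IsRealizationOn d M S p) {u v : V} (hu : u ∈ S) (hv : v ∈ S) :
    dist (q u) (q v) = dist (p u) (p v) := by
  rw [← sq_eq_sq₀ dist_nonneg dist_nonneg, hq u hu v hv, hp u hu v hv]

/-- If `w` is spanned by the other vertices of `S`, a realization of `S \ {w}` can be extended to a
realization of `S` by moving only the point indexed by `w`. -/
theorem IsRealizationOn.exists_update {V : Type*} [DecidableEq V] {d : ℕ} {M : V → V → ℝ}
    {S B : Set V} {w : V} {q p : V → EuclideanSpace ℝ (Fin d)}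
    (hq : IsRealizationOn d M S q) (hp : IsRealizationOn d M (S \ {w}) p)
    (hwS : w ∈ S) (hB : B ⊆ S \ {w}) (hw : q w ∈ affineSpan ℝ (q '' B)) :
    ∃ y, IsRealizationOn d M S (Function.update p w y) := by
  have hq' : IsRealizationOn d M (S \ {w}) q := hq.mono Set.sdiff_subset
  obtain ⟨y, hy⟩ := exists_dist_eq_of_mem_affineSpan
    (fun u hu v hv => hq'.dist_eq hp hu hv) (affineSpan_mono ℝ (Set.image_mono hB) hw)
  refine ⟨y, fun u hu v hv => ?_⟩
  by_cases huw : u = w <;> by_cases hvw : v = w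
  · subst huw hvw
    simpa using hq v hv v hv
  · subst huw
    rw [Function.update_self, Function.update_of_ne hvw, dist_comm, hy v ⟨hv, hvw⟩, dist_comm,
      hq u hu v hv]
  · subst hvw
    rw [Function.update_self, Function.update_of_ne huw, hy u ⟨hu, huw⟩, hq u hu v hv]
  · rw [Function.update_of_ne huw, Function.update_of_ne hvw, hp u ⟨hu, huw⟩ v ⟨hv, hvw⟩]

/-- Claim 3.7: the irrelevant-vertex claim in the edge-clique-cover compression.
Deleting the vertex `w` yields an equivalent instance of `d`-EDM completion. -/
theorem irrelevant_vertex_cliqueCover {n : ℕ} (d k : ℕ) (hd : 1 ≤ d) (hk : 1 ≤ k)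
    (G : SimpleGraph (Fin n)) (M : Fin n → Fin n → ℝ)
    (hM : IsPartialMatrix G M)
    (C : Fin k → Set (Fin n)) (hC : ∀ j, G.IsClique (C j))
    (hcover : ∀ u v : Fin n, G.Adj u v → ∃ j, u ∈ C j ∧ v ∈ C j)
    (hemb : ∀ j, IsEmbeddableOn d M (C j))
    (i : Fin k) (X : Fin k → Set (Fin n))
    (hX : ∀ j, IsMetricBasisOn d M (C i ∩ C j) (X j))
    (w : Fin n) (hw : w ∈ C i \ ⋃ j : Fin k, X j) :
    IsCompletable d G M ↔ IsCompletableOn d G M {w}ᶜ := by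
  classical
  refine ⟨fun ⟨p, hp⟩ => ⟨p, fun u _ v _ => hp u trivial v trivial⟩, fun ⟨p, hp⟩ => ?_⟩
  have hwX : ∀ j, w ∉ X j := fun j hj => hw.2 (Set.mem_iUnion.2 ⟨j, hj⟩)
  have hpC : ∀ j, IsRealizationOn d M (C j \ {w}) p := by
    rintro j u ⟨hu, huw⟩ v ⟨hv, hvw⟩
    rcases eq_or_ne u v with rfl | huv
    · simp [hM.2.2 u]
    · exact hp u huw v hvw (hC j hu hv huv)
  have hext : ∀ j, w ∈ C j → ∃ y, IsRealizationOn d M (C j) (Function.update p w y) := by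
    intro j hwj
    obtain ⟨q, hq⟩ := hemb j
    exact hq.exists_update (hpC j) hwj
      (fun v hv => ⟨((hX j).1 hv).2, ne_of_mem_of_not_mem hv (hwX j)⟩)
      (((hX j).2.2 q (hq.mono Set.inter_subset_right)).2 w ⟨hw.1, hwj⟩)
  obtain ⟨y, hy⟩ := hext i hw.1
  have huniq : ∀ j, w ∈ C j → IsRealizationOn d M (C j) (Function.update p w y) := by
    intro j hwj
    obtain ⟨z, hz⟩ := hext j hwj
    have hy' := hy.mono (Set.inter_subset_left (t := C j))
    have hz' := hz.mono (Set.inter_subset_right (s := C i))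
    suffices h : y = z from h ▸ hz
    refine eq_of_mem_affineSpan_of_forall_dist_eq
      (s := Function.update p w y '' X j) ?_ ?_
    · simpa using ((hX j).2.2 _ hy').2 w ⟨hw.1, hwj⟩
    · rintro _ ⟨v, hv, rfl⟩
      have := hy'.dist_eq hz' ((hX j).1 hv) ⟨hw.1, hwj⟩
      have hvw : v ≠ w := ne_of_mem_of_not_mem hv (hwX j)
      simpa [Function.update_of_ne hvw] using this
  refine ⟨Function.update p w y, fun u _ v _ huv => ?_⟩
  obtain ⟨j, hu, hv⟩ := hcover u v huv
  by_cases hwj : w ∈ C j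
  · exact huniq j hwj u hu v hv
  · have huw : u ≠ w := ne_of_mem_of_not_mem hu hwj
    have hvw : v ≠ w := ne_of_mem_of_not_mem hv hwj
    rw [Function.update_of_ne huw, Function.update_of_ne hvw]
    exact hp u huw v hvw huv
end

section
/- Let G be a graph on vertex set [n], let X be a set of non-adjacent pairs of vertices of G such that the graph G′ = G + X (obtained by adding the pairs in X as edges) is chordal, let M be a G-partial matrix and let d ∈ ℕ. Then M is d-completable if and only if there exists an assignment ν : X → ℝ_{≥0} such that, writing M̃ for the (G′)-partial matrix that agrees with M on the edges of G and has M̃_{uv} = M̃_{vu} = ν({u,v}) for every pair {u,v} ∈ X, for every maximal clique C of G′ the fully specified principal submatrix M̃[C] is d-embeddable. -/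
open scoped Classical

/-- `G` has an induced cycle on `m` vertices. -/
def HasInducedCycle {V : Type*} (G : SimpleGraph V) (m : ℕ) : Prop :=
  ∃ f : ZMod m → V, Function.Injective f ∧
    (∀ i : ZMod m, G.Adj (f i) (f (i + 1))) ∧
    (∀ i j : ZMod m, j ≠ i + 1 → j ≠ i - 1 → j ≠ i → ¬ G.Adj (f i) (f j))

/-- A graph is chordal if it has no induced cycle of length at least `4`. -/
def IsChordal {V : Type*} (G : SimpleGraph V) : Prop :=
  ∀ m : ℕ, 4 ≤ m → ¬ HasInducedCycle G m

section IsometryExtension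

variable {E : Type*} [NormedAddCommGroup E] [InnerProductSpace ℝ E]

/-- Linear combinations of two families with the same Gram matrix have the same norm. -/
theorem norm_linearCombination_eq_of_inner_eq {ι : Type*} {f g : ι → E}
    (h : ∀ i j, inner ℝ (f i) (f j) = inner ℝ (g i) (g j)) (c : ι →₀ ℝ) :
    ‖Finsupp.linearCombination ℝ f c‖ = ‖Finsupp.linearCombination ℝ g c‖ := by
  have key : inner ℝ (Finsupp.linearCombination ℝ f c) (Finsupp.linearCombination ℝ f c) =
      inner ℝ (Finsupp.linearCombination ℝ g c) (Finsupp.linearCombination ℝ g c) := by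
    simp only [Finsupp.linearCombination_apply, Finsupp.sum, sum_inner, inner_sum,
      real_inner_smul_left, real_inner_smul_right, h]
  rw [real_inner_self_eq_norm_sq, real_inner_self_eq_norm_sq] at key
  exact (sq_eq_sq₀ (norm_nonneg _) (norm_nonneg _)).1 key

variable [FiniteDimensional ℝ E]

/-- Two families with the same Gram matrix differ by a linear isometry. -/
theorem exists_linearIsometry_of_inner_eq {ι : Type*} {f g : ι → E}
    (h : ∀ i j, inner ℝ (f i) (f j) = inner ℝ (g i) (g j)) :
    ∃ L : E →ₗᵢ[ℝ] E, ∀ i, L (f i) = g i := by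
  let A := Finsupp.linearCombination ℝ f
  let B := Finsupp.linearCombination ℝ g
  have hAB : ∀ c, ‖A c‖ = ‖B c‖ := norm_linearCombination_eq_of_inner_eq h
  obtain ⟨s, hs⟩ := A.rangeRestrict.exists_rightInverse_of_surjective A.range_rangeRestrict
  have hs' : ∀ y, A (s y) = y := fun y => congrArg Subtype.val (LinearMap.congr_fun hs y)
  let L : LinearMap.range A →ₗᵢ[ℝ] E :=
    { toLinearMap := B ∘ₗ s
      norm_map' := fun y => by
        rw [LinearMap.comp_apply, ← hAB, hs', Submodule.coe_norm] }
  refine ⟨L.extend, fun i => ?_⟩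
  have hA : A (Finsupp.single i 1) = f i := by simp [A]
  have hB : B (Finsupp.single i 1) = g i := by simp [B]
  let y : LinearMap.range A := ⟨f i, Finsupp.single i 1, hA⟩
  have hL : L.extend (f i) = B (s y) := L.extend_apply y
  rw [hL, ← hB, ← sub_eq_zero, ← map_sub, ← norm_eq_zero, ← hAB, map_sub, hs', hA, sub_self,
    norm_zero]

/-- Two families with the same pairwise distances differ by an isometry. -/
theorem exists_isometry_of_dist_eq {ι : Type*} {f g : ι → E}
    (h : ∀ i j, dist (f i) (f j) = dist (g i) (g j)) :
    ∃ φ : E → E, Isometry φ ∧ ∀ i, φ (f i) = g i := by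
  rcases isEmpty_or_nonempty ι with hι | ⟨⟨o⟩⟩
  · exact ⟨id, isometry_id, fun i => hι.elim i⟩
  have hinner : ∀ i j, inner ℝ (f i - f o) (f j - f o) = inner ℝ (g i - g o) (g j - g o) := by
    intro i j
    simp only [real_inner_eq_norm_mul_self_add_norm_mul_self_sub_norm_sub_mul_self_div_two,
      sub_sub_sub_cancel_right, ← dist_eq_norm, h]
  obtain ⟨L, hL⟩ := exists_linearIsometry_of_inner_eq hinner
  refine ⟨fun x => L (x - f o) + g o, Isometry.of_dist_eq fun x y => ?_, fun i => ?_⟩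
  · rw [dist_add_right, L.isometry.dist_eq, dist_sub_right]
  · simp [hL]

end IsometryExtension

section Chordal

variable {V : Type*} {H : SimpleGraph V}

/-- The representative of a cyclic successor in `ZMod (k + 2)`. -/
theorem val_add_one_cases {k : ℕ} (i : ZMod (k + 2)) :
    (i.val ≤ k ∧ (i + 1).val = i.val + 1) ∨ (i.val = k + 1 ∧ (i + 1).val = 0) := by
  have : Fact (1 < k + 2) := ⟨by lia⟩
  have hi := i.val_lt
  have h1 : (1 : ZMod (k + 2)).val = 1 := ZMod.val_one _
  rcases Nat.lt_or_ge i.val (k + 1) with h | h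
  · left
    refine ⟨by lia, ?_⟩
    rw [ZMod.val_add_of_lt (by lia), h1]
  · right
    refine ⟨by lia, ?_⟩
    rw [ZMod.val_add_of_le (by lia), h1]
    lia

/-- An induced path of length `k`, together with an apex adjacent exactly to its
two ends, is an induced cycle. -/
theorem hasInducedCycle_of_path_of_apex {k : ℕ} {a : V} {p : ℕ → V}
    (hinj : ∀ i ≤ k, ∀ j ≤ k, p i = p j → i = j)
    (hadj : ∀ i < k, H.Adj (p i) (p (i + 1)))
    (hind : ∀ i ≤ k, ∀ j ≤ k, H.Adj (p i) (p j) → i ≤ j + 1)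
    (ha : ∀ i ≤ k, a ≠ p i) (ha0 : H.Adj a (p 0)) (hak : H.Adj a (p k))
    (hna : ∀ i, 0 < i → i < k → ¬ H.Adj a (p i)) :
    HasInducedCycle H (k + 2) := by
  let f : ZMod (k + 2) → V := fun i => if i.val ≤ k then p i.val else a
  have f_le : ∀ i : ZMod (k + 2), i.val ≤ k → f i = p i.val := fun i hi => if_pos hi
  have f_gt : ∀ i : ZMod (k + 2), ¬ i.val ≤ k → f i = a := fun i hi => if_neg hi
  have hval : ∀ i j : ZMod (k + 2), i.val = j.val → i = j :=
    fun i j h => ZMod.val_injective _ h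
  refine ⟨f, ?_, ?_, ?_⟩
  · intro i j hij
    apply hval
    have hi := i.val_lt
    have hj := j.val_lt
    by_cases hik : i.val ≤ k <;> by_cases hjk : j.val ≤ k
    · rw [f_le i hik, f_le j hjk] at hij
      exact hinj _ hik _ hjk hij
    · rw [f_le i hik, f_gt j hjk] at hij
      exact (ha _ hik hij.symm).elim
    · rw [f_gt i hik, f_le j hjk] at hij
      exact (ha _ hjk hij).elim
    · lia
  · intro i
    rcases val_add_one_cases i with ⟨h, h'⟩ | ⟨h, h'⟩
    · rw [f_le i h]
      by_cases hik : i.val < k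
      · rw [f_le _ (by lia), h']
        exact hadj _ hik
      · rw [f_gt _ (by lia), show i.val = k by lia]
        exact hak.symm
    · rw [f_gt i (by lia), f_le _ (by lia), h']
      exact ha0
  · intro i j h1 h2 h3 hij
    have h2' : i ≠ j + 1 := fun h => h2 (by rw [h, add_sub_cancel_right])
    have hne : i.val ≠ j.val := fun h => h3 (hval _ _ h.symm)
    have h1v : j.val ≠ (i + 1).val := fun h => h1 (hval _ _ h)
    have h2v : i.val ≠ (j + 1).val := fun h => h2' (hval _ _ h)
    have hci := val_add_one_cases i
    have hcj := val_add_one_cases j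
    have hi := i.val_lt
    have hj := j.val_lt
    by_cases hik : i.val ≤ k <;> by_cases hjk : j.val ≤ k
    · rw [f_le i hik, f_le j hjk] at hij
      have := hind _ hik _ hjk hij
      have := hind _ hjk _ hik hij.symm
      lia
    · rw [f_le i hik, f_gt j hjk] at hij
      exact hna i.val (by lia) (by lia) hij.symm
    · rw [f_gt i hik, f_le j hjk] at hij
      exact hna j.val (by lia) (by lia) hij
    · lia

/-- The edges of `H` with both ends in `T`, as a graph on the whole vertex set. -/
def edgesWithin (H : SimpleGraph V) (T : Set V) : SimpleGraph V where
  Adj u v := H.Adj u v ∧ u ∈ T ∧ v ∈ T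
  symm := ⟨fun _ _ h => ⟨h.1.symm, h.2.2, h.2.1⟩⟩
  loopless := ⟨fun _ h => h.1.ne rfl⟩

theorem edgesWithin_mono {T T' : Set V} (h : T ⊆ T') : edgesWithin H T ≤ edgesWithin H T' :=
  fun _ _ huv => ⟨huv.1, h huv.2.1, h huv.2.2⟩

theorem mem_of_reachable_edgesWithin {T : Set V} {u v : V}
    (h : (edgesWithin H T).Reachable u v) (hu : u ∈ T) : v ∈ T := by
  obtain ⟨w⟩ := h
  induction w with
  | nil => exact hu
  | cons hadj _ ih => exact ih hadj.2.2

/-- In a chordal graph, two neighbours of `a` joined by a path through non-neighbours of `a` are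
adjacent. -/
theorem IsChordal.adj_of_reachable_edgesWithin (hH : IsChordal H) {a x y : V} {T : Set V}
    (haT : a ∉ T) (hT : ∀ v ∈ T, ¬ H.Adj a v) (hax : H.Adj a x) (hay : H.Adj a y) (hxy : x ≠ y)
    (hreach : (edgesWithin H (insert x (insert y T))).Reachable x y) : H.Adj x y := by
  by_contra hnadj
  set K := edgesWithin H (insert x (insert y T)) with hK
  obtain ⟨w, hw⟩ := hreach.exists_walk_length_eq_dist
  have hmem : ∀ i, w.getVert i ∈ insert x (insert y T) := fun i =>
    mem_of_reachable_edgesWithin (w.take i).reachable (Set.mem_insert _ _)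
  have hreach' : ∀ i, K.Reachable x (w.getVert i) := fun i => (w.take i).reachable
  have hdist : ∀ i ≤ w.length, K.dist x (w.getVert i) = i := by
    intro i hi
    have h1 := K.dist_le (w.take i)
    have h2 := K.dist_le (w.drop i)
    have h3 := (hreach' i).dist_triangle_left y
    rw [SimpleGraph.Walk.take_length] at h1
    rw [SimpleGraph.Walk.drop_length] at h2
    lia
  have hinj : ∀ i ≤ w.length, ∀ j ≤ w.length, w.getVert i = w.getVert j → i = j := by
    intro i hi j hj h
    rw [← hdist i hi, ← hdist j hj, h]
  have hlen : 2 ≤ w.length := by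
    rw [hw]
    exact hreach.one_lt_dist_of_ne_of_not_adj hxy fun h => hnadj h.1
  refine hH (w.length + 2) (by lia)
    (hasInducedCycle_of_path_of_apex (a := a) (p := w.getVert) hinj ?_ ?_ ?_ ?_ ?_ ?_)
  · exact fun i hi => (w.adj_getVert_succ hi).1
  · intro i hi j hj hij
    have hadj : K.Adj (w.getVert i) (w.getVert j) := ⟨hij, hmem i, hmem j⟩
    have h1 := K.dist_le ((w.take j).concat hadj.symm)
    rw [SimpleGraph.Walk.length_concat, SimpleGraph.Walk.take_length, hdist i hi] at h1
    lia
  · intro i _ h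
    rcases hmem i with h' | h' | h'
    · exact hax.ne (h.trans h')
    · exact hay.ne (h.trans h')
    · exact haT (h ▸ h')
  · simpa using hax
  · simpa using hay
  · intro i h0 hi
    rcases hmem i with h' | h' | h'
    · have := hinj i hi.le 0 (by lia) (by simpa using h')
      lia
    · have := hinj i hi.le w.length le_rfl (by simpa using h')
      lia
    · exact hT _ h'

/-- A vertex set of a chordal graph that is not a clique has two proper subsets which
meet in a clique and together contain all its edges. -/
theorem IsChordal.exists_clique_separation (hH : IsChordal H) {S : Set V} (hS : ¬ H.IsClique S) :
    ∃ S₁ S₂ : Set V, S₁ ⊂ S ∧ S₂ ⊂ S ∧ H.IsClique (S₁ ∩ S₂) ∧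
      ∀ u ∈ S, ∀ v ∈ S, H.Adj u v → (u ∈ S₁ ∧ v ∈ S₁) ∨ (u ∈ S₂ ∧ v ∈ S₂) := by
  obtain ⟨a, haS, b, hbS, hab, hnab⟩ : ∃ a ∈ S, ∃ b ∈ S, a ≠ b ∧ ¬ H.Adj a b := by
    simpa [SimpleGraph.IsClique, Set.Pairwise] using hS
  let T : Set V := {v | v ∈ S ∧ v ≠ a ∧ ¬ H.Adj a v}
  have hbT : b ∈ T := ⟨hbS, hab.symm, hnab⟩
  let B : Set V := {v | (edgesWithin H T).Reachable b v}
  have hBT : B ⊆ T := fun v hv => mem_of_reachable_edgesWithin hv hbT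
  have hbB : b ∈ B := SimpleGraph.Reachable.refl b
  let C : Set V := {v | v ∈ S ∧ v ∉ B ∧ ∃ u ∈ B, H.Adj u v}
  have hCa : ∀ v ∈ C, v ≠ a ∧ H.Adj a v := by
    rintro v ⟨hvS, hvB, u, huB, huv⟩
    have hva : v ≠ a := by
      rintro rfl
      exact (hBT huB).2.2 huv.symm
    refine ⟨hva, by_contra fun hnav => hvB ?_⟩
    have hadj : (edgesWithin H T).Adj u v := ⟨huv, hBT huB, hvS, hva, hnav⟩
    exact SimpleGraph.Reachable.trans huB hadj.reachable
  refine ⟨B ∪ C, S \ B, ⟨?_, ?_⟩, ⟨Set.sdiff_subset, ?_⟩, ?_, ?_⟩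
  · rintro v (hv | hv)
    · exact (hBT hv).1
    · exact hv.1
  · intro h
    rcases h haS with h | h
    · exact (hBT h).2.1 rfl
    · exact (hCa a h).1 rfl
  · exact fun h => (h hbS).2 hbB
  · have hC : ∀ v ∈ (B ∪ C) ∩ (S \ B), v ∈ C := fun v hv => hv.1.resolve_left hv.2.2
    intro x hx y hy hxy
    obtain ⟨-, -, u, huB, hux⟩ := hC x hx
    obtain ⟨-, -, v, hvB, hvy⟩ := hC y hy
    refine hH.adj_of_reachable_edgesWithin (T := T) (fun h => h.2.1 rfl) (fun v hv => hv.2.2)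
      (hCa x (hC x hx)).2 (hCa y (hC y hy)).2 hxy ?_
    have hle : T ⊆ insert x (insert y T) :=
      (Set.subset_insert _ _).trans (Set.subset_insert _ _)
    have hux' : (edgesWithin H (insert x (insert y T))).Adj u x :=
      ⟨hux, hle (hBT huB), Set.mem_insert _ _⟩
    have hvy' : (edgesWithin H (insert x (insert y T))).Adj v y :=
      ⟨hvy, hle (hBT hvB), Set.mem_insert_of_mem _ (Set.mem_insert _ _)⟩
    have huv : (edgesWithin H T).Reachable u v :=
      SimpleGraph.Reachable.trans (SimpleGraph.Reachable.symm huB) hvB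
    exact hux'.symm.reachable.trans ((huv.mono (edgesWithin_mono hle)).trans hvy'.reachable)
  · intro u hu v hv huv
    by_cases huB : u ∈ B <;> by_cases hvB : v ∈ B
    · exact Or.inl ⟨Or.inl huB, Or.inl hvB⟩
    · exact Or.inl ⟨Or.inl huB, Or.inr ⟨hv, hvB, u, huB, huv⟩⟩
    · exact Or.inl ⟨Or.inr ⟨hu, huB, v, hvB, huv.symm⟩, Or.inl hvB⟩
    · exact Or.inr ⟨⟨hu, huB⟩, ⟨hv, hvB⟩⟩

/-- Realizations on two vertex sets that meet in a clique and cover all edges can be glued. -/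
theorem IsCompletableOn.glue {d : ℕ} {N : V → V → ℝ} {S S₁ S₂ : Set V}
    (h₁ : IsCompletableOn d H N S₁) (h₂ : IsCompletableOn d H N S₂)
    (hclique : H.IsClique (S₁ ∩ S₂))
    (hcover : ∀ u ∈ S, ∀ v ∈ S, H.Adj u v → (u ∈ S₁ ∧ v ∈ S₁) ∨ (u ∈ S₂ ∧ v ∈ S₂)) :
    IsCompletableOn d H N S := by
  obtain ⟨p, hp⟩ := h₁
  obtain ⟨q, hq⟩ := h₂
  have hdist : ∀ u v : ↥(S₁ ∩ S₂), dist (q u) (q v) = dist (p u) (p v) := by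
    rintro ⟨u, hu₁, hu₂⟩ ⟨v, hv₁, hv₂⟩
    rcases eq_or_ne u v with rfl | huv
    · simp
    have hadj := hclique ⟨hu₁, hu₂⟩ ⟨hv₁, hv₂⟩ huv
    rw [← sq_eq_sq₀ dist_nonneg dist_nonneg, hp u hu₁ v hv₁ hadj, hq u hu₂ v hv₂ hadj]
  obtain ⟨φ, hφ, hφC⟩ := exists_isometry_of_dist_eq hdist
  have hr₂ : ∀ v ∈ S₂, (if v ∈ S₁ then p v else φ (q v)) = φ (q v) := by
    intro v hv
    split_ifs with h
    · exact (hφC ⟨v, h, hv⟩).symm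
    · rfl
  refine ⟨fun v => if v ∈ S₁ then p v else φ (q v), fun u hu v hv huv => ?_⟩
  rcases hcover u hu v hv huv with ⟨hu', hv'⟩ | ⟨hu', hv'⟩
  · simp only [if_pos hu', if_pos hv']
    exact hp u hu' v hv' huv
  · simp only [hr₂ u hu', hr₂ v hv', hφ.dist_eq]
    exact hq u hu' v hv' huv

/-- A partial matrix on a finite chordal graph is completable on every vertex set as soon as all
its cliques are embeddable. -/
theorem IsChordal.isCompletableOn [Finite V] (hH : IsChordal H) {d : ℕ} {N : V → V → ℝ}
    (hclique : ∀ C : Set V, H.IsClique C → IsEmbeddableOn d N C) (S : Set V) :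
    IsCompletableOn d H N S := by
  induction S using WellFoundedLT.induction with
  | ind S ih =>
    by_cases hS : H.IsClique S
    · obtain ⟨q, hq⟩ := hclique S hS
      exact ⟨q, fun u hu v hv _ => hq u hu v hv⟩
    · obtain ⟨S₁, S₂, h₁, h₂, hC, hcover⟩ := hH.exists_clique_separation hS
      exact (ih S₁ h₁).glue (ih S₂ h₂) hC hcover

end Chordal

/-- Restated correctness of the fill-in algorithm: a `G`-partial matrix `M` is
`d`-completable iff, for a chordal supergraph `G'` of `G` (so the added pairs
`X = E(G') \ E(G)` form a fill-in of `G`), there is a nonnegative symmetric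
assignment `ν` of values to the added pairs such that every maximal clique `C` of
`G'` induces a `d`-embeddable fully specified principal submatrix of the extended
partial matrix `M̃`. -/
theorem completable_iff_fillin_assignment {n : ℕ} (d : ℕ)
    (G G' : SimpleGraph (Fin n)) (hle : G ≤ G') (hchordal : IsChordal G')
    (M : Fin n → Fin n → ℝ) (hM : IsPartialMatrix G M) :
    IsCompletable d G M ↔
      ∃ ν : Fin n → Fin n → ℝ,
        (∀ u v, ν u v = ν v u) ∧
        (∀ u v, G'.Adj u v → ¬ G.Adj u v → 0 ≤ ν u v) ∧
        ∀ C : Set (Fin n), G'.IsClique C →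
          (∀ C' : Set (Fin n), G'.IsClique C' → C ⊆ C' → C' = C) →
          IsEmbeddableOn d
            (fun u v => if G.Adj u v then M u v else if u = v then 0 else ν u v) C := by
  constructor
  · rintro ⟨p, hp⟩
    refine ⟨fun u v => dist (p u) (p v) ^ 2, fun u v => congrArg (· ^ 2) (dist_comm _ _),
      fun _ _ _ _ => sq_nonneg _, fun C _ _ => ⟨p, fun u _ v _ => ?_⟩⟩
    by_cases huv : G.Adj u v
    · simpa [huv] using hp u trivial v trivial huv
    · rcases eq_or_ne u v with rfl | hne
      · simp
      · simp [huv, hne]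
  · rintro ⟨ν, -, -, hν⟩
    have hclique : ∀ C : Set (Fin n), G'.IsClique C → IsEmbeddableOn d
        (fun u v => if G.Adj u v then M u v else if u = v then 0 else ν u v) C := by
      intro C hC
      obtain ⟨D, hCD, hD⟩ := Finite.exists_le_maximal (p := G'.IsClique) hC
      obtain ⟨q, hq⟩ := hν D hD.prop fun C' hC' hDC' => (hD.eq_of_le hC' hDC').symm
      exact ⟨q, fun u hu v hv => hq u (hCD hu) v (hCD hv)⟩
    obtain ⟨p, hp⟩ := hchordal.isCompletableOn hclique Set.univ
    refine ⟨p, fun u hu v hv huv => ?_⟩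
    exact (hp u hu v hv (hle huv)).trans (if_pos huv)
end
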